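/- arXiv:2508.15271 — 3 statements merged into one kernel-verified Lean document; each statement's English description precedes it below -/
import Mathlib

section
/- Let G be a graph with m edges and unit Perron–Frobenius eigenvector x. If λ(G)² ≥ (1 + δ)·m for some 0 < δ ≤ 0.79, then every coordinate of x satisfies x_v < δ^{−4}·m^{−1/4}. -/
open Finset Matrix

/-- `lam` is the largest adjacency eigenvalue (spectral radius) of `G`. -/
def IsSpectralRadius {V : Type*} [Fintype V] [DecidableEq V] (G : SimpleGraph V)
    [DecidableRel G.Adj] (lam : ℝ) : Prop :=
  (∃ x : V → ℝ, x ≠ 0 ∧ (G.adjMatrix ℝ) *ᵥ x = lam • x) ∧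
  ∀ μ : ℝ, (∃ x : V → ℝ, x ≠ 0 ∧ (G.adjMatrix ℝ) *ᵥ x = μ • x) → μ ≤ lam

section

variable {V : Type*} [Fintype V] (G : SimpleGraph V) [DecidableRel G.Adj]

lemma sum_sum_adjMatrix_eq_two_mul_card :
    ∑ u, ∑ w, G.adjMatrix ℝ u w = 2 * (G.edgeFinset.card : ℝ) := by
  have h := G.sum_degrees_eq_twice_card_edges
  have h' : (∑ u, (G.degree u : ℝ)) = 2 * (G.edgeFinset.card : ℝ) := by exact_mod_cast h
  rw [← h']
  refine Finset.sum_congr rfl fun u _ => ?_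
  simp [SimpleGraph.adjMatrix_apply, Finset.sum_boole, ← SimpleGraph.card_neighborFinset_eq_degree,
    SimpleGraph.neighborFinset_eq_filter]

variable {G} {lam : ℝ} {x : V → ℝ}

lemma sum_adjMatrix_mul_eq (hxeig : (G.adjMatrix ℝ) *ᵥ x = lam • x) (u : V) :
    ∑ w, G.adjMatrix ℝ u w * x w = lam * x u := by
  simpa [Matrix.mulVec, dotProduct] using congrFun hxeig u

lemma sum_sum_adjMatrix_mul_mul_eq (hxunit : ∑ w, x w ^ 2 = 1)
    (hxeig : (G.adjMatrix ℝ) *ᵥ x = lam • x) :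
    ∑ u, ∑ w, G.adjMatrix ℝ u w * (x u * x w) = lam := by
  calc ∑ u, ∑ w, G.adjMatrix ℝ u w * (x u * x w)
      = ∑ u, x u * ∑ w, G.adjMatrix ℝ u w * x w := by
        refine Finset.sum_congr rfl fun u _ => ?_
        rw [Finset.mul_sum]
        exact Finset.sum_congr rfl fun w _ => by ring
    _ = ∑ u, lam * x u ^ 2 := by
        refine Finset.sum_congr rfl fun u _ => ?_
        rw [sum_adjMatrix_mul_eq hxeig]; ring
    _ = lam := by rw [← Finset.mul_sum, hxunit, mul_one]

lemma eigenvalue_sq_le_two_mul_card (hxunit : ∑ w, x w ^ 2 = 1)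
    (hxeig : (G.adjMatrix ℝ) *ᵥ x = lam • x) :
    lam ^ 2 ≤ 2 * (G.edgeFinset.card : ℝ) := by
  have hcs := Finset.sum_mul_sq_le_sq_mul_sq (Finset.univ : Finset (V × V))
    (fun p => G.adjMatrix ℝ p.1 p.2) (fun p => x p.1 * x p.2)
  have hA : ∑ p : V × V, G.adjMatrix ℝ p.1 p.2 ^ 2 = 2 * (G.edgeFinset.card : ℝ) := by
    rw [← sum_sum_adjMatrix_eq_two_mul_card G, Fintype.sum_prod_type]
    refine Finset.sum_congr rfl fun u _ => Finset.sum_congr rfl fun w _ => ?_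
    by_cases h : G.Adj u w <;> simp [h]
  have hx : ∑ p : V × V, (x p.1 * x p.2) ^ 2 = 1 := by
    simp only [Fintype.sum_prod_type, mul_pow, ← Finset.mul_sum, hxunit, mul_one]
  rw [hA, hx, Fintype.sum_prod_type, mul_one] at hcs
  rwa [sum_sum_adjMatrix_mul_mul_eq hxunit hxeig] at hcs

/-- At a vertex `v` where the Perron vector is maximal, counting walks of length two from `v`
gives `2 λ² x_v² ≤ 2 m x_v² + λ`. -/
lemma two_mul_sq_mul_sq_le_of_forall_le (hx0 : ∀ w, 0 ≤ x w) (hxunit : ∑ w, x w ^ 2 = 1)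
    (hxeig : (G.adjMatrix ℝ) *ᵥ x = lam • x) {v : V} (hv : ∀ w, x w ≤ x v) :
    2 * (lam ^ 2 * x v ^ 2) ≤ 2 * (G.edgeFinset.card : ℝ) * x v ^ 2 + lam := by
  have hwalk : ∑ u, ∑ w, G.adjMatrix ℝ u w * (G.adjMatrix ℝ v u * x w * x v)
      = lam ^ 2 * x v ^ 2 := by
    calc ∑ u, ∑ w, G.adjMatrix ℝ u w * (G.adjMatrix ℝ v u * x w * x v)
        = ∑ u, x v * lam * (G.adjMatrix ℝ v u * x u) := by
          refine Finset.sum_congr rfl fun u _ => ?_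
          rw [show x v * lam * (G.adjMatrix ℝ v u * x u)
            = x v * G.adjMatrix ℝ v u * (lam * x u) by ring,
            ← sum_adjMatrix_mul_eq hxeig u, Finset.mul_sum]
          exact Finset.sum_congr rfl fun w _ => by ring
      _ = lam ^ 2 * x v ^ 2 := by
          rw [← Finset.mul_sum, sum_adjMatrix_mul_eq hxeig]; ring
  have hwalk' : ∑ u, ∑ w, G.adjMatrix ℝ u w * (G.adjMatrix ℝ v w * x u * x v)
      = lam ^ 2 * x v ^ 2 := by
    rw [← hwalk, Finset.sum_comm]
    refine Finset.sum_congr rfl fun u _ => Finset.sum_congr rfl fun w _ => ?_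
    simp only [SimpleGraph.adjMatrix_apply, G.adj_comm w u]
  calc 2 * (lam ^ 2 * x v ^ 2)
      = ∑ u, ∑ w, G.adjMatrix ℝ u w *
          (G.adjMatrix ℝ v u * x w * x v + G.adjMatrix ℝ v w * x u * x v) := by
        simp only [mul_add, Finset.sum_add_distrib, hwalk, hwalk']; ring
    _ ≤ ∑ u, ∑ w, (G.adjMatrix ℝ u w * x v ^ 2 + G.adjMatrix ℝ u w * (x u * x w)) := by
        refine Finset.sum_le_sum fun u _ => Finset.sum_le_sum fun w _ => ?_
        rw [← mul_add]
        refine mul_le_mul_of_nonneg_left ?_ ?_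
        · have h1 := mul_nonneg (sub_nonneg.2 (hv u)) (sub_nonneg.2 (hv w))
          have h2 := mul_nonneg (hx0 u) (hx0 w)
          have h3 := mul_nonneg (hx0 v) (sub_nonneg.2 (hv u))
          have h4 := mul_nonneg (hx0 v) (sub_nonneg.2 (hv w))
          have h5 := sq_nonneg (x v)
          by_cases hu : G.Adj v u <;> by_cases hw : G.Adj v w <;>
            simp only [SimpleGraph.adjMatrix_apply, hu, hw, if_true, if_false] <;> nlinarith
        · by_cases h : G.Adj u w <;> simp [h]
    _ = 2 * (G.edgeFinset.card : ℝ) * x v ^ 2 + lam := by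
        simp only [Finset.sum_add_distrib, sum_sum_adjMatrix_mul_mul_eq hxunit hxeig,
          ← Finset.sum_mul, sum_sum_adjMatrix_eq_two_mul_card]

end

/-- If `λ(G)² ≥ (1+δ)m` with `0 < δ ≤ 0.79`, then every Perron coordinate is
less than `δ⁻⁴ m^{-1/4}`. -/
theorem stmt_3 {V : Type*} [Fintype V] [DecidableEq V] (G : SimpleGraph V)
    [DecidableRel G.Adj] (lam : ℝ) (hlam : IsSpectralRadius G lam)
    (x : V → ℝ) (hx0 : ∀ w, 0 ≤ x w) (hxunit : ∑ w, x w ^ 2 = 1)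
    (hxeig : (G.adjMatrix ℝ) *ᵥ x = lam • x)
    (hm : 0 < G.edgeFinset.card)
    (δ : ℝ) (hδ0 : 0 < δ) (hδ1 : δ ≤ 0.79)
    (h : (1 + δ) * (G.edgeFinset.card : ℝ) ≤ lam ^ 2) :
    ∀ v : V, x v < (δ ^ 4)⁻¹ * (G.edgeFinset.card : ℝ) ^ (-(1 / 4 : ℝ)) := by
  intro v
  obtain ⟨v₀, -, hmax⟩ := Finset.exists_max_image Finset.univ x ⟨v, Finset.mem_univ v⟩
  have hmax' : ∀ w, x w ≤ x v₀ := fun w => hmax w (Finset.mem_univ w)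
  refine (hmax' v).trans_lt ?_
  have hm' : (0 : ℝ) < G.edgeFinset.card := by exact_mod_cast hm
  have hwalk := two_mul_sq_mul_sq_le_of_forall_le hx0 hxunit hxeig hmax'
  have hsq := eigenvalue_sq_le_two_mul_card hxunit hxeig
  set m : ℝ := (G.edgeFinset.card : ℝ)
  set M := x v₀
  have hlin : 2 * (δ * m * M ^ 2) ≤ lam := by
    nlinarith [mul_le_mul_of_nonneg_right h (sq_nonneg M)]
  have hquad : (2 * (δ * m * M ^ 2)) ^ 2 ≤ 2 * m :=
    (pow_le_pow_left₀ (by positivity) hlin 2).trans hsq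
  have hM : δ ^ 2 * m * M ^ 4 < 1 := by
    have : m * (2 * (δ ^ 2 * m * M ^ 4)) ≤ m * 1 := by nlinarith
    linarith [le_of_mul_le_mul_left this hm']
  have hδ : δ ^ 16 ≤ δ ^ 2 :=
    pow_le_pow_of_le_one hδ0.le (hδ1.trans (by norm_num)) (by norm_num)
  refine lt_of_pow_lt_pow_left₀ 4 (by positivity) ?_
  have hroot : (m ^ (-(1 / 4 : ℝ))) ^ 4 = m⁻¹ := by
    rw [← Real.rpow_natCast, ← Real.rpow_mul hm'.le, ← Real.rpow_neg_one]
    norm_num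
  rw [mul_pow, hroot, inv_pow, ← pow_mul, ← mul_inv, ← one_div, lt_div_iff₀ (by positivity)]
  have hmM : 0 ≤ m * M ^ 4 := by positivity
  norm_num only [Nat.reduceMul]
  linarith [mul_le_mul_of_nonneg_right hδ hmM]
end

section
/- For every graph F with chromatic number χ(F) = r + 1 ≥ 3 and every ε > 0, there exists C = C(F, ε) such that every F-free graph G with m edges satisfies λ(G) ≤ sqrt((1 − 1/r + ε)·2m) + C. -/
open Finset Matrix

/-- Deleting low-degree vertices: a symmetric kernel with zero diagonal whose total weight exceeds
`c n²` has a large principal part with all row sums at least about `c` times its size. -/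
lemma exists_subset_forall_mul_card_le_sum {V : Type*} [Fintype V] [DecidableEq V] (a : V → V → ℝ)
    (symm : ∀ i j, a i j = a j i) (diag : ∀ i, a i i = 0) (le_one : ∀ i j, a i j ≤ 1)
    {c : ℝ} (hc : 0 ≤ c) :
    ∃ U : Finset V, (∑ i, ∑ j, a i j) - c * (Fintype.card V : ℝ) ^ 2 ≤ (#U : ℝ) ^ 2 ∧
      ∀ u ∈ U, c * #U - c ≤ ∑ j ∈ U, a u j := by
  let Φ : Finset V → ℝ := fun U => ∑ i ∈ U, ∑ j ∈ U, a i j - c * (#U : ℝ) ^ 2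
  obtain ⟨U, -, hU⟩ := exists_max_image (univ : Finset (Finset V)) Φ univ_nonempty
  refine ⟨U, ?_, fun u hu => ?_⟩
  · have h := hU univ (mem_univ _)
    have h1 : ∑ i ∈ U, ∑ j ∈ U, a i j ≤ ∑ i ∈ U, ∑ j ∈ U, (1 : ℝ) :=
      sum_le_sum fun i _ => sum_le_sum fun j _ => le_one i j
    simp only [sum_const, nsmul_eq_mul, mul_one] at h1
    simp only [Φ, card_univ] at h
    nlinarith [mul_nonneg hc (sq_nonneg (#U : ℝ))]
  · have h := hU (U.erase u) (mem_univ _)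
    have e1 : ∑ i ∈ U, ∑ j ∈ U, a i j =
        ∑ i ∈ U.erase u, ∑ j ∈ U.erase u, a i j + 2 * ∑ j ∈ U, a u j := by
      have hcol : ∀ i, ∑ j ∈ U, a i j = ∑ j ∈ U.erase u, a i j + a i u :=
        fun i => (sum_erase_add U (a i) hu).symm
      rw [← sum_erase_add U _ hu, sum_congr rfl fun i _ => hcol i, sum_add_distrib]
      have := sum_erase_add U (fun i => a i u) hu
      simp only [diag, add_zero] at this
      rw [this, sum_congr rfl fun i _ => symm i u]
      ring
    have hcard : (#(U.erase u) : ℝ) = #U - 1 := by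
      rw [card_erase_of_mem hu, Nat.cast_pred (card_pos.2 ⟨u, hu⟩)]
    simp only [Φ, hcard, e1] at h
    nlinarith

open Filter in
/-- Edge version of the Erdős–Stone theorem, counting ordered pairs. -/
lemma eventually_sum_adjMatrix_le {W : Type*} [Fintype W] {F : SimpleGraph W} {r : ℕ}
    (hr : 1 ≤ r) (hF : F.Colorable (r + 1)) {ε : ℝ} (hε : 0 < ε) :
    ∀ᶠ n : ℕ in atTop, ∀ (G : SimpleGraph (Fin n)) [DecidableRel G.Adj], F.Free G →
      ∑ i, ∑ j, G.adjMatrix ℝ i j ≤ (1 - 1 / (r : ℝ) + ε) * (n : ℝ) ^ 2 := by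
  classical
  have hr0 : (0 : ℝ) ≤ 1 - 1 / (r : ℝ) := by
    rw [sub_nonneg, div_le_one (by positivity)]; exact_mod_cast hr
  obtain ⟨N, hN⟩ := eventually_atTop.1
    (SimpleGraph.eventually_completeEquipartiteGraph_isContained_of_minDegree
      (half_pos (half_pos hε)) r (Fintype.card W))
  set c : ℝ := 1 - 1 / (r : ℝ) + ε / 2 with hc
  set K : ℝ := max (max N 1) (4 * c / ε) with hK
  filter_upwards [eventually_ge_atTop ⌈K ^ 2 * (2 / ε)⌉₊, eventually_ge_atTop 1]
    with n hn hn1 G _ hfree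
  by_contra! hlt
  obtain ⟨U, hU, hdeg⟩ := exists_subset_forall_mul_card_le_sum (fun i j => G.adjMatrix ℝ i j)
    (fun i j => by simp [SimpleGraph.adjMatrix_apply, G.adj_comm])
    (fun i => by simp) (fun i j => by
      simp only [SimpleGraph.adjMatrix_apply]; split_ifs <;> norm_num) (c := c) (by positivity)
  rw [Fintype.card_fin] at hU
  have hKU : K ≤ #U := by
    have h1 : K ^ 2 * (2 / ε) ≤ n := Nat.ceil_le.1 hn
    have h2 : (1 : ℝ) ≤ n := by exact_mod_cast hn1
    have h3 : K ^ 2 ≤ ε / 2 * n := by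
      calc K ^ 2 = ε / 2 * (K ^ 2 * (2 / ε)) := by field_simp
        _ ≤ _ := by gcongr
    have h4 : K ^ 2 ≤ (#U : ℝ) ^ 2 := by nlinarith
    exact le_of_sq_le_sq h4 (by positivity)
  have hNU : N ≤ #U := by exact_mod_cast ((le_max_left _ _).trans (le_max_left _ _)).trans hKU
  have h1U : (1 : ℝ) ≤ #U := ((le_max_right _ _).trans (le_max_left _ _)).trans hKU
  have h4U : c ≤ ε / 4 * #U := by
    have := (le_max_right _ _).trans hKU
    rw [div_le_iff₀ hε] at this
    linarith
  let H : SimpleGraph (U : Set (Fin n)) := G.induce U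
  have hcard : Fintype.card (U : Set (Fin n)) = #U := by simp
  let e : H ≃g H.overFin hcard := H.overFinIso hcard
  have hmin : (1 - 1 / (r : ℝ) + ε / 2 / 2) * (#U : ℝ) ≤ (H.overFin hcard).minDegree := by
    have : Nonempty (Fin #U) := ⟨⟨0, by exact_mod_cast h1U⟩⟩
    obtain ⟨v, hv⟩ := (H.overFin hcard).exists_minimal_degree_vertex
    rw [hv]
    obtain ⟨w, rfl⟩ := e.surjective v
    have h1 : (H.overFin hcard).degree (e w) = H.degree w := e.degree_eq w
    have h2 : (H.degree w : ℝ) = ∑ j ∈ U, G.adjMatrix ℝ w j := by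
      rw [← SimpleGraph.card_neighborFinset_eq_degree]
      simp only [SimpleGraph.adjMatrix_apply, sum_boole]
      norm_cast
      refine card_bij (fun x _ => (x : Fin n)) ?_ ?_ ?_
      · intro x hx
        simp only [SimpleGraph.mem_neighborFinset] at hx
        exact mem_filter.2 ⟨x.2, hx⟩
      · intro x _ y _ h
        exact Subtype.ext h
      · intro y hy
        rw [mem_filter] at hy
        exact ⟨⟨y, hy.1⟩, by simpa [H] using hy.2, rfl⟩
    rw [h1, h2]
    have := hdeg w w.2
    rw [hc] at this h4U
    linarith
  have hcont := hN _ hNU hmin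
  refine hfree ?_
  obtain ⟨C⟩ := hF
  have h3 := SimpleGraph.isContained_completeEquipartiteGraph_of_colorable C (Fintype.card W)
    (fun c => by exact Fintype.card_subtype_le _)
  exact (h3.trans hcont).trans (e.symm.isContained.trans ⟨SimpleGraph.Copy.induce G U⟩)

/-- Second marginals of the product weight on `Fin n → V` induced by `p`. -/
lemma sum_prod_mul_apply_apply {V : Type*} [Fintype V] [DecidableEq V] (p : V → ℝ)
    (M : V → V → ℝ) {n : ℕ} {i j : Fin n} (hij : i ≠ j) :
    ∑ φ : Fin n → V, (∏ k, p (φ k)) * M (φ i) (φ j) =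
      (∑ v, p v) ^ (n - 2) * ∑ u, ∑ v, M u v * (p u * p v) := by
  have key : ∀ u v, ∑ φ : Fin n → V, (∏ k, p (φ k)) *
      ((if φ i = u then 1 else 0) * (if φ j = v then 1 else 0)) =
      (∑ v, p v) ^ (n - 2) * (p u * p v) := by
    intro u v
    let g : Fin n → V → ℝ := fun k w =>
      p w * ((if k = i then (if w = u then 1 else 0) else 1) *
        (if k = j then (if w = v then 1 else 0) else 1))
    have h1 : ∀ φ : Fin n → V, (∏ k, p (φ k)) *
        ((if φ i = u then 1 else 0) * (if φ j = v then 1 else 0)) = ∏ k, g k (φ k) := by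
      intro φ
      simp only [g, prod_mul_distrib, prod_ite_eq', mem_univ, if_true]
    rw [sum_congr rfl fun φ _ => h1 φ, ← Fintype.prod_sum]
    have hi : ∑ w, g i w = p u := by simp [g, hij]
    have hj : ∑ w, g j w = p v := by simp [g, hij.symm]
    have hrest : ∀ k ∈ (univ.erase i).erase j, ∑ w, g k w = ∑ w, p w := by
      intro k hk
      simp only [mem_erase] at hk
      simp [g, hk.1, hk.2.1]
    rw [← mul_prod_erase univ _ (mem_univ i),
      ← mul_prod_erase (univ.erase i) _ (mem_erase.2 ⟨hij.symm, mem_univ j⟩), hi, hj,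
      prod_congr rfl hrest, prod_const, card_erase_of_mem (mem_erase.2 ⟨hij.symm, mem_univ j⟩),
      card_erase_of_mem (mem_univ i), card_univ, Fintype.card_fin, Nat.sub_sub]
    ring
  have expand : ∀ φ : Fin n → V, (∏ k, p (φ k)) * M (φ i) (φ j) =
      ∑ u, ∑ v, M u v * ((∏ k, p (φ k)) *
        ((if φ i = u then 1 else 0) * (if φ j = v then 1 else 0))) := by
    intro φ
    rw [sum_eq_single (φ i) (fun u _ hu => by simp [hu.symm]) (by simp),
      sum_eq_single (φ j) (fun v _ hv => by simp [hv.symm]) (by simp)]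
    simp
    ring
  rw [sum_congr rfl fun φ _ => expand φ, sum_comm, mul_sum]
  refine sum_congr rfl fun u _ => ?_
  rw [sum_comm, mul_sum]
  refine sum_congr rfl fun v _ => ?_
  rw [← mul_sum, key]
  ring

open Filter in
/-- Weighted Erdős–Stone theorem: if no vertex carries much weight, the weighted edge density of
an `F`-free graph is asymptotically at most `1 - 1 / r`. -/
lemma exists_forall_sum_adjMatrix_mul_le {W : Type*} [Fintype W] {F : SimpleGraph W} {r : ℕ}
    (hr : 1 ≤ r) (hF : F.Colorable (r + 1)) {ε : ℝ} (hε : 0 < ε) :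
    ∃ δ : ℝ, 0 < δ ∧ ∀ (V : Type) [Fintype V] [DecidableEq V] (G : SimpleGraph V)
      [DecidableRel G.Adj], F.Free G → ∀ p : V → ℝ, (∀ v, 0 ≤ p v) → (∀ v, p v ≤ δ) →
      ∑ v, p v ≤ 1 →
      ∑ u, ∑ v, G.adjMatrix ℝ u v * (p u * p v) ≤ (1 - 1 / (r : ℝ)) * (∑ v, p v) ^ 2 + ε := by
  classical
  have hr0 : (0 : ℝ) ≤ 1 - 1 / (r : ℝ) := by
    rw [sub_nonneg, div_le_one (by positivity)]; exact_mod_cast hr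
  have hr1 : 1 - 1 / (r : ℝ) ≤ 1 := by
    have : (0 : ℝ) ≤ 1 / (r : ℝ) := by positivity
    linarith
  set c : ℝ := 1 - 1 / (r : ℝ) with hc
  obtain ⟨N, hN, hNε⟩ := ((eventually_sum_adjMatrix_le hr hF
    (show 0 < ε / 4 by positivity)).and (eventually_ge_atTop ⌈4 / ε + 2⌉₊)).exists
  replace hNε : 4 / ε + 2 ≤ N := Nat.ceil_le.1 hNε
  have hN2 : (2 : ℝ) ≤ N := by
    have : 0 < 4 / ε := by positivity
    linarith
  have hNε' : 4 + 2 * ε ≤ ε * N := by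
    calc 4 + 2 * ε = ε * (4 / ε + 2) := by field_simp
      _ ≤ _ := by gcongr
  refine ⟨ε / (4 * (N : ℝ) ^ 2), by positivity, fun V _ _ G _ hG p hp hpδ hp1 => ?_⟩
  set δ : ℝ := ε / (4 * (N : ℝ) ^ 2) with hδ
  set P : ℝ := ∑ v, p v with hP
  have hP0 : 0 ≤ P := sum_nonneg fun v _ => hp v
  set ρ : ℝ := ∑ u, ∑ v, G.adjMatrix ℝ u v * (p u * p v) with hρ
  rcases hP0.eq_or_lt with h0 | hPpos
  · have hpz : ∀ v, p v = 0 := fun v =>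
      (sum_eq_zero_iff_of_nonneg fun v _ => hp v).1 h0.symm v (mem_univ v)
    have : ρ = 0 := by simp [hρ, hpz]
    rw [this]
    positivity
  set D : V → V → ℝ := fun u v => if u = v then 1 else 0 with hD
  set T : Finset (Fin N × Fin N) := univ.offDiag with hT
  have hTcard : (#T : ℝ) = (N : ℝ) ^ 2 - N := by
    rw [hT, offDiag_card, card_univ, Fintype.card_fin, Nat.cast_sub (Nat.le_mul_self N)]
    push_cast; ring
  have hA0 : ∀ u v, 0 ≤ G.adjMatrix ℝ u v := fun u v => by
    simp only [SimpleGraph.adjMatrix_apply]; split_ifs <;> norm_num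
  have hA1 : ∀ u v, G.adjMatrix ℝ u v ≤ 1 := fun u v => by
    simp only [SimpleGraph.adjMatrix_apply]; split_ifs <;> norm_num
  have hD0 : ∀ u v, 0 ≤ D u v := fun u v => by
    simp only [hD]; split_ifs <;> norm_num
  have pointwise : ∀ φ : Fin N → V, ∑ x ∈ T, G.adjMatrix ℝ (φ x.1) (φ x.2) ≤
      (c + ε / 4) * (N : ℝ) ^ 2 + (N : ℝ) ^ 2 * ∑ x ∈ T, D (φ x.1) (φ x.2) := by
    intro φ
    by_cases hφ : Function.Injective φ
    · have hfree : F.Free (G.comap φ) := fun h =>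
        hG (h.trans ⟨⟨SimpleGraph.Hom.comap φ G, hφ⟩⟩)
      have h1 := hN (G.comap φ) hfree
      have h2 : ∑ x ∈ T, G.adjMatrix ℝ (φ x.1) (φ x.2) ≤
          ∑ i, ∑ j, (G.comap φ).adjMatrix ℝ i j := by
        rw [← Fintype.sum_prod_type' (f := fun i j => (G.comap φ).adjMatrix ℝ i j)]
        simp only [SimpleGraph.adjMatrix_apply, SimpleGraph.comap_adj]
        exact sum_le_sum_of_subset_of_nonneg (subset_univ _)
          fun _ _ _ => by split_ifs <;> norm_num
      have h3 : 0 ≤ ∑ x ∈ T, D (φ x.1) (φ x.2) := sum_nonneg fun _ _ => hD0 _ _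
      exact (h2.trans h1).trans (le_add_of_nonneg_right (by positivity))
    · simp only [Function.Injective, not_forall] at hφ
      obtain ⟨i, j, hij, hne⟩ := hφ
      have h1 : 1 ≤ ∑ x ∈ T, D (φ x.1) (φ x.2) := by
        calc (1 : ℝ) = D (φ (i, j).1) (φ (i, j).2) := by simp [hD, hij]
          _ ≤ _ := single_le_sum (f := fun x : Fin N × Fin N => D (φ x.1) (φ x.2))
            (fun _ _ => hD0 _ _) (by simp [hT, hne])
      have h2 : ∑ x ∈ T, G.adjMatrix ℝ (φ x.1) (φ x.2) ≤ ∑ x ∈ T, (1 : ℝ) :=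
        sum_le_sum fun _ _ => hA1 _ _
      rw [sum_const, nsmul_eq_mul, mul_one, hTcard] at h2
      have h3 : 0 ≤ (c + ε / 4) * (N : ℝ) ^ 2 := by positivity
      nlinarith [sq_nonneg (N : ℝ)]
  have swap : ∀ M : V → V → ℝ,
      ∑ φ : Fin N → V, (∏ k, p (φ k)) * ∑ x ∈ T, M (φ x.1) (φ x.2) =
        ((N : ℝ) ^ 2 - N) * (P ^ (N - 2) * ∑ u, ∑ v, M u v * (p u * p v)) := by
    intro M
    simp only [mul_sum]
    rw [sum_comm, sum_congr rfl fun x hx =>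
      sum_prod_mul_apply_apply p M (by simpa [hT] using hx), sum_const, nsmul_eq_mul, hTcard]
    simp only [mul_sum]
    rfl
  have total : ∑ φ : Fin N → V, ∏ k, p (φ k) = P ^ (N - 2) * P ^ 2 := by
    rw [← Fintype.prod_sum (fun (_ : Fin N) v => p v), prod_const, card_univ, Fintype.card_fin,
      ← pow_add, Nat.sub_add_cancel (by exact_mod_cast hN2)]
  have hDρ : ∑ u, ∑ v, D u v * (p u * p v) ≤ δ := by
    calc ∑ u, ∑ v, D u v * (p u * p v) = ∑ u, p u * p u := by simp [hD]
      _ ≤ ∑ u, δ * p u := sum_le_sum fun u _ => mul_le_mul_of_nonneg_right (hpδ u) (hp u)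
      _ = δ * P := by rw [mul_sum]
      _ ≤ δ := mul_le_of_le_one_right (by positivity) hp1
  have hsum := sum_le_sum fun (φ : Fin N → V) (_ : φ ∈ univ) =>
    mul_le_mul_of_nonneg_left (pointwise φ) (prod_nonneg (s := univ) fun k _ => hp (φ k))
  have hrhs : ∑ φ : Fin N → V, (∏ k, p (φ k)) *
      ((c + ε / 4) * (N : ℝ) ^ 2 + (N : ℝ) ^ 2 * ∑ x ∈ T, D (φ x.1) (φ x.2)) =
      P ^ (N - 2) * P ^ 2 * ((c + ε / 4) * (N : ℝ) ^ 2) + (N : ℝ) ^ 2 *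
        (((N : ℝ) ^ 2 - N) * (P ^ (N - 2) * ∑ u, ∑ v, D u v * (p u * p v))) := by
    rw [← swap D, ← total, sum_mul, mul_sum, ← sum_add_distrib]
    exact sum_congr rfl fun φ _ => by ring
  replace hsum := (swap fun u v => G.adjMatrix ℝ u v).symm.trans_le (hsum.trans_eq hrhs)
  have hPN : 0 < P ^ (N - 2) := by positivity
  have hNN : 0 < (N : ℝ) ^ 2 - N := by nlinarith
  have h1 : ((N : ℝ) ^ 2 - N) * ρ ≤ P ^ 2 * ((c + ε / 4) * (N : ℝ) ^ 2) +
      (N : ℝ) ^ 2 * (((N : ℝ) ^ 2 - N) * δ) := by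
    refine le_of_mul_le_mul_left ?_ hPN
    calc P ^ (N - 2) * (((N : ℝ) ^ 2 - N) * ρ)
        = ((N : ℝ) ^ 2 - N) * (P ^ (N - 2) * ρ) := by ring
      _ ≤ _ := hsum
      _ ≤ P ^ (N - 2) * P ^ 2 * ((c + ε / 4) * (N : ℝ) ^ 2) + (N : ℝ) ^ 2 *
        (((N : ℝ) ^ 2 - N) * (P ^ (N - 2) * δ)) := by gcongr
      _ = _ := by ring
  have h2 : (N : ℝ) ^ 2 * δ = ε / 4 := by rw [hδ]; field_simp
  have h3 : (c + ε / 4) * (N : ℝ) ^ 2 ≤ (c + ε / 2) * ((N : ℝ) ^ 2 - N) := by nlinarith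
  have h4 : P ^ 2 ≤ 1 := by nlinarith
  refine le_of_mul_le_mul_left ?_ hNN
  calc ((N : ℝ) ^ 2 - N) * ρ
      ≤ P ^ 2 * ((c + ε / 2) * ((N : ℝ) ^ 2 - N)) + ((N : ℝ) ^ 2 - N) * (ε / 4) := by
        rw [← h2]
        refine h1.trans (add_le_add (by gcongr) (le_of_eq (by ring)))
    _ = ((N : ℝ) ^ 2 - N) * (c * P ^ 2 + ε / 2 * P ^ 2 + ε / 4) := by ring
    _ ≤ _ := by
        gcongr ?_ * ?_
        nlinarith

/-- Cauchy–Schwarz for the bilinear form of a kernel with values in `[0, 1]`. -/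
lemma sum_mul_mul_le_sqrt_mul_sqrt {V : Type*} [Fintype V] (A g : V → V → ℝ) (x : V → ℝ)
    (hA : ∀ u v, 0 ≤ A u v) :
    ∑ u, ∑ v, A u v * g u v * (x u * x v) ≤
      √(∑ u, ∑ v, A u v) * √(∑ u, ∑ v, A u v * g u v ^ 2 * (x u ^ 2 * x v ^ 2)) := by
  simp only [← Fintype.sum_prod_type']
  refine Real.le_sqrt_of_sq_le ?_ |>.trans_eq
    (Real.sqrt_mul (sum_nonneg fun z _ => hA z.1 z.2) _)
  exact sum_sq_le_sum_mul_sum_of_sq_le_mul _ (fun z _ => hA z.1 z.2)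
    (fun z _ => mul_nonneg (mul_nonneg (hA z.1 z.2) (sq_nonneg _)) (by positivity))
    fun z _ => le_of_eq (by ring)

/-- Splitting one term of a quadratic form according to the sizes of the two coordinates. -/
lemma mul_mul_le_of_thresholds {α β κ A a b : ℝ} (hκ : 0 ≤ κ) (hκβ : κ ≤ β)
    (hA0 : 0 ≤ A) (hA1 : A ≤ 1) (ha : 0 ≤ a) (hb : 0 ≤ b) :
    A * (a * b) ≤ (if β ≤ a then a else 0) * (if β ≤ b then b else 0)
      + (A * (if β ≤ a ∧ a < α then 1 else 0) * (a * b)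
        + A * (if β ≤ b ∧ b < α then 1 else 0) * (a * b))
      + ((if α ≤ a then a else 0) * (if κ ≤ b ∧ b < β then b else 0)
        + (if κ ≤ a ∧ a < β then a else 0) * (if α ≤ b then b else 0))
      + A * (β * κ)
      + A * (if α ≤ a ∧ b < κ ∨ a < κ ∧ α ≤ b ∨ (κ ≤ a ∧ a < β) ∧ (κ ≤ b ∧ b < β)
          then 1 else 0) * (a * b) := by
  have hab : 0 ≤ a * b := mul_nonneg ha hb
  have hAab : 0 ≤ A * (a * b) := mul_nonneg hA0 hab
  have hβ : 0 ≤ β := hκ.trans hκβ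
  have hAβκ : 0 ≤ A * (β * κ) := by positivity
  have hle : A * (a * b) ≤ a * b := mul_le_of_le_one_left hab hA1
  have p1 : 0 ≤ (if β ≤ a then a else 0) * (if β ≤ b then b else 0) := by positivity
  have p2 : 0 ≤ A * (if β ≤ a ∧ a < α then 1 else 0) * (a * b) := by positivity
  have p3 : 0 ≤ A * (if β ≤ b ∧ b < α then 1 else 0) * (a * b) := by positivity
  have p4 : 0 ≤ (if α ≤ a then a else 0) * (if κ ≤ b ∧ b < β then b else 0) := by positivity
  have p5 : 0 ≤ (if κ ≤ a ∧ a < β then a else 0) * (if α ≤ b then b else 0) := by positivity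
  have p6 : 0 ≤ A * (if α ≤ a ∧ b < κ ∨ a < κ ∧ α ≤ b ∨ (κ ≤ a ∧ a < β) ∧ (κ ≤ b ∧ b < β)
          then 1 else 0) * (a * b) := by positivity
  by_cases h1 : β ≤ a ∧ a < α
  · simp only [if_pos h1, mul_one] at p2 ⊢; linarith
  by_cases h2 : β ≤ b ∧ b < α
  · simp only [if_pos h2, mul_one] at p3 ⊢; linarith
  by_cases h3 : α ≤ a ∧ b < κ ∨ a < κ ∧ α ≤ b ∨ (κ ≤ a ∧ a < β) ∧ (κ ≤ b ∧ b < β)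
  · simp only [if_pos h3, mul_one] at p6 ⊢; linarith
  by_cases h4 : β ≤ a ∧ β ≤ b
  · simp only [if_pos h4.1, if_pos h4.2] at p1 ⊢; linarith
  by_cases h5 : α ≤ a ∧ (κ ≤ b ∧ b < β)
  · simp only [if_pos h5.1, if_pos h5.2] at p4 ⊢; linarith
  by_cases h6 : (κ ≤ a ∧ a < β) ∧ α ≤ b
  · simp only [if_pos h6.1, if_pos h6.2] at p5 ⊢; linarith
  have h7 : a * b ≤ β * κ := by
    have : a ≤ β ∧ b ≤ κ ∨ a ≤ κ ∧ b ≤ β := by grind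
    rcases this with h | h
    · exact mul_le_mul h.1 h.2 hb hβ
    · rw [mul_comm β]; exact mul_le_mul h.1 h.2 hb hκ
  have h8 := mul_le_mul_of_nonneg_left h7 hA0
  linarith

/-- The entries of a vector of norm at most one exceeding `t` sum to at most `1 / t`. -/
lemma sum_ite_le_inv {V : Type*} [Fintype V] {x : V → ℝ} (hx2 : ∑ v, x v ^ 2 = 1)
    {t : ℝ} (ht : 0 < t) (P : V → Prop) [DecidablePred P] (hP : ∀ v, P v → t ≤ x v) :
    ∑ v, (if P v then x v else 0) ≤ t⁻¹ := by
  calc ∑ v, (if P v then x v else 0) ≤ ∑ v, t⁻¹ * x v ^ 2 := by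
        refine sum_le_sum fun v _ => ?_
        split_ifs with h
        · have := hP v h
          rw [inv_mul_eq_div, le_div_iff₀ ht]
          nlinarith
        · positivity
    _ = t⁻¹ := by rw [← mul_sum, hx2, mul_one]

/-- Bound for a quadratic form on a unit vector with few entries of medium size, when the form is
sparse in density on the entries between `κ = 1 / (α η lam)` and `β = η² α`. -/
lemma sum_mul_mul_le_of_thresholds {V : Type*} [Fintype V] (A : V → V → ℝ)
    (hA0 : ∀ u v, 0 ≤ A u v) (hA1 : ∀ u v, A u v ≤ 1) (hAs : ∀ u v, A u v = A v u)
    (x : V → ℝ) (hx : ∀ v, 0 ≤ x v) (hx2 : ∑ v, x v ^ 2 = 1)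
    {α η lam c ε : ℝ} (hα : 0 < α) (hη : 0 < η) (hη1 : η ≤ 1) (hlam : 0 < lam)
    (hκ : (α * η * lam)⁻¹ ≤ η ^ 2 * α) (hc : 1 / 2 ≤ c)
    (hm : ∑ u, ∑ v, A u v ≤ 2 * lam ^ 2) (hle : lam ≤ ∑ u, ∑ v, A u v * (x u * x v))
    (hmid : ∑ v, (if η ^ 2 * α ≤ x v ∧ x v < α then x v ^ 2 else 0) ≤ η ^ 2)
    (hdens : ∀ p : V → ℝ, (∀ v, 0 ≤ p v) → (∀ v, p v ≤ (η ^ 2 * α) ^ 2) → ∑ v, p v ≤ 1 →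
      ∑ u, ∑ v, A u v * (p u * p v) ≤ c * (∑ v, p v) ^ 2 + ε) :
    ∑ u, ∑ v, A u v * (x u * x v) ≤ (η ^ 2 * α)⁻¹ ^ 2 +
      √(∑ u, ∑ v, A u v) * (6 * η + √(c + ε)) := by
  set β : ℝ := η ^ 2 * α with hβ
  set κ : ℝ := (α * η * lam)⁻¹ with hκdef
  set m2 : ℝ := ∑ u, ∑ v, A u v with hm2
  have hβ0 : 0 < β := by positivity
  have hκ0 : 0 < κ := by positivity
  have hβα : β ≤ α := mul_le_of_le_one_left hα.le (pow_le_one₀ hη.le hη1)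
  have hm20 : 0 ≤ m2 := sum_nonneg fun u _ => sum_nonneg fun v _ => hA0 u v
  have hlam_le : lam ≤ √m2 := by
    have h := sum_mul_mul_le_sqrt_mul_sqrt A (fun _ _ => 1) x hA0
    have h1 : ∑ u, ∑ v, A u v * (1 : ℝ) ^ 2 * (x u ^ 2 * x v ^ 2) ≤ 1 := by
      calc _ ≤ ∑ u, ∑ v, x u ^ 2 * x v ^ 2 := by
            refine sum_le_sum fun u _ => sum_le_sum fun v _ => ?_
            rw [one_pow, mul_one]
            exact mul_le_of_le_one_left (by positivity) (hA1 u v)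
        _ = 1 := by simp only [← mul_sum, hx2, mul_one]
    simp only [mul_one] at h
    exact hle.trans (h.trans (mul_le_of_le_one_right (Real.sqrt_nonneg _)
      (Real.sqrt_le_one.2 (by simpa using h1))))
  have big : ∑ u, ∑ v, (if β ≤ x u then x u else 0) * (if β ≤ x v then x v else 0) ≤
      β⁻¹ ^ 2 := by
    simp only [← mul_sum, ← sum_mul, ← sq]
    exact pow_le_pow_left₀ (sum_nonneg fun v _ => by have := hx v; positivity)
      (sum_ite_le_inv hx2 hβ0 _ fun _ h => h) 2
  have mid : ∑ u, ∑ v, A u v * (if β ≤ x u ∧ x u < α then 1 else 0) * (x u * x v) ≤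
      √m2 * η := by
    refine (sum_mul_mul_le_sqrt_mul_sqrt A (fun u _ => if β ≤ x u ∧ x u < α then 1 else 0) x
      hA0).trans (mul_le_mul_of_nonneg_left (Real.sqrt_le_iff.2 ⟨hη.le, ?_⟩)
        (Real.sqrt_nonneg _))
    refine le_trans ?_ hmid
    calc _ ≤ ∑ u, ∑ v, (if β ≤ x u ∧ x u < α then x u ^ 2 else 0) * x v ^ 2 := by
          refine sum_le_sum fun u _ => sum_le_sum fun v _ => ?_
          split_ifs
          · rw [one_pow, mul_one]
            exact mul_le_of_le_one_left (by positivity) (hA1 u v)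
          · simp
      _ = _ := by simp only [← mul_sum, hx2, mul_one]
  have mid' : ∑ u, ∑ v, A u v * (if β ≤ x v ∧ x v < α then 1 else 0) * (x u * x v) ≤
      √m2 * η := by
    rw [sum_comm]
    refine le_trans (le_of_eq ?_) mid
    refine sum_congr rfl fun u _ => sum_congr rfl fun v _ => ?_
    rw [hAs, mul_comm (x u)]
  have cross : (∑ v, if α ≤ x v then x v else 0) *
      (∑ v, if κ ≤ x v ∧ x v < β then x v else 0) ≤ η * lam := by
    calc _ ≤ α⁻¹ * κ⁻¹ := by
          refine mul_le_mul (sum_ite_le_inv hx2 hα _ fun _ h => h)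
            (sum_ite_le_inv hx2 hκ0 _ fun _ h => h.1) ?_ (by positivity)
          exact sum_nonneg fun v _ => by have := hx v; positivity
      _ = η * lam := by rw [hκdef]; field_simp
  have small : m2 * (β * κ) ≤ 2 * (η * lam) := by
    calc m2 * (β * κ) ≤ 2 * lam ^ 2 * (β * κ) := by gcongr
      _ = 2 * (η * lam) := by rw [hκdef, hβ]; field_simp
  have main : ∑ u, ∑ v, A u v * (if α ≤ x u ∧ x v < κ ∨ x u < κ ∧ α ≤ x v ∨
      (κ ≤ x u ∧ x u < β) ∧ (κ ≤ x v ∧ x v < β) then 1 else 0) * (x u * x v) ≤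
      √m2 * √(c + ε) := by
    refine (sum_mul_mul_le_sqrt_mul_sqrt A (fun u v => if α ≤ x u ∧ x v < κ ∨
      x u < κ ∧ α ≤ x v ∨ (κ ≤ x u ∧ x u < β) ∧ (κ ≤ x v ∧ x v < β) then 1 else 0) x
      hA0).trans (mul_le_mul_of_nonneg_left (Real.sqrt_le_sqrt ?_) (Real.sqrt_nonneg _))
    set l : V → ℝ := fun v => if α ≤ x v then x v ^ 2 else 0 with hl
    set s : V → ℝ := fun v => if κ ≤ x v ∧ x v < β then x v ^ 2 else 0 with hs
    set w : V → ℝ := fun v => if x v < κ then x v ^ 2 else 0 with hw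
    have hl0 : ∀ v, 0 ≤ l v := fun v => by positivity
    have hs0 : ∀ v, 0 ≤ s v := fun v => by positivity
    have hw0 : ∀ v, 0 ≤ w v := fun v => by positivity
    have hsum : ∑ v, l v + ∑ v, s v + ∑ v, w v ≤ 1 := by
      rw [← hx2, ← sum_add_distrib, ← sum_add_distrib]
      refine sum_le_sum fun v _ => ?_
      have := sq_nonneg (x v)
      simp only [hl, hs, hw]
      split_ifs <;> grind
    have hL := sum_nonneg fun v (_ : v ∈ univ) => hl0 v
    have hS := sum_nonneg fun v (_ : v ∈ univ) => hs0 v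
    have hW := sum_nonneg fun v (_ : v ∈ univ) => hw0 v
    have hss := hdens s hs0 (fun v => by
      simp only [hs]
      split_ifs with h
      · exact pow_le_pow_left₀ (hx v) h.2.le 2
      · positivity) (by linarith)
    calc _ ≤ ∑ u, ∑ v, (l u * w v + w u * l v + A u v * (s u * s v)) := by
          refine sum_le_sum fun u _ => sum_le_sum fun v _ => ?_
          have h1 := mul_nonneg (hl0 u) (hw0 v)
          have h2 := mul_nonneg (hw0 u) (hl0 v)
          have h3 := mul_nonneg (hA0 u v) (mul_nonneg (hs0 u) (hs0 v))
          have hxx : 0 ≤ x u ^ 2 * x v ^ 2 := by positivity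
          have h4 : A u v * (x u ^ 2 * x v ^ 2) ≤ x u ^ 2 * x v ^ 2 :=
            mul_le_of_le_one_left hxx (hA1 u v)
          split_ifs with h
          · rw [one_pow, mul_one]
            rcases h with h | h | h
            · have : l u * w v = x u ^ 2 * x v ^ 2 := by simp [hl, hw, h.1, h.2]
              linarith
            · have : w u * l v = x u ^ 2 * x v ^ 2 := by simp [hl, hw, h.1, h.2]
              linarith
            · have : s u * s v = x u ^ 2 * x v ^ 2 := by
                simp only [hs, if_pos h.1, if_pos h.2]
              rw [this] at h3 ⊢
              linarith
          · simp only [ne_eq, OfNat.ofNat_ne_zero, not_false_eq_true, zero_pow, mul_zero, zero_mul]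
            linarith
      _ = 2 * ((∑ v, l v) * ∑ v, w v) + ∑ u, ∑ v, A u v * (s u * s v) := by
          simp only [sum_add_distrib, ← mul_sum, ← sum_mul]
          ring
      _ ≤ c + ε := by
          have h1 := sq_nonneg (∑ v, l v - ∑ v, w v)
          have h2 := mul_nonneg (add_nonneg hL hW) hS
          have h3 : (∑ v, l v + ∑ v, s v + ∑ v, w v) ^ 2 ≤ 1 :=
            pow_le_one₀ (by positivity) hsum
          have h4 : c * ((∑ v, l v + ∑ v, w v) ^ 2 + (∑ v, s v) ^ 2) ≤ c * 1 :=
            mul_le_mul_of_nonneg_left (by linarith) (by linarith)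
          have h5 : 1 / 2 * (∑ v, l v + ∑ v, w v) ^ 2 ≤ c * (∑ v, l v + ∑ v, w v) ^ 2 := by
            gcongr
          linarith
  have total := sum_le_sum fun u (_ : u ∈ univ) => sum_le_sum fun v (_ : v ∈ univ) =>
    mul_mul_le_of_thresholds (α := α) hκ0.le hκ (hA0 u v) (hA1 u v) (hx u) (hx v)
  simp only [sum_add_distrib] at total
  have e1 : ∑ u, ∑ v, A u v * (β * κ) = m2 * (β * κ) := by simp only [← sum_mul, hm2]
  have e2 : ∑ u, ∑ v, (if α ≤ x u then x u else 0) * (if κ ≤ x v ∧ x v < β then x v else 0) =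
      (∑ v, if α ≤ x v then x v else 0) * (∑ v, if κ ≤ x v ∧ x v < β then x v else 0) := by
    rw [sum_mul_sum]
  have e3 : ∑ u, ∑ v, (if κ ≤ x u ∧ x u < β then x u else 0) * (if α ≤ x v then x v else 0) =
      (∑ v, if α ≤ x v then x v else 0) * (∑ v, if κ ≤ x v ∧ x v < β then x v else 0) := by
    rw [mul_comm, sum_mul_sum]
  rw [e1, e2, e3] at total
  have : η * lam ≤ √m2 * η := by rw [mul_comm]; gcongr
  linarith

/-- Pigeonhole: some level `(t (j + 1), t j]` of a decreasing sequence carries little mass. -/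
lemma exists_sum_level_le {V : Type*} [Fintype V] (x : V → ℝ) (hx2 : ∑ v, x v ^ 2 = 1)
    {t : ℕ → ℝ} (ht : Antitone t) {J : ℕ} {θ : ℝ} (hJ : 1 ≤ J * θ) (hJ0 : 0 < J) :
    ∃ j < J, ∑ v, (if t (j + 1) ≤ x v ∧ x v < t j then x v ^ 2 else 0) ≤ θ := by
  by_contra! h
  have h1 : ∑ j ∈ range J, θ <
      ∑ j ∈ range J, ∑ v, (if t (j + 1) ≤ x v ∧ x v < t j then x v ^ 2 else 0) :=
    sum_lt_sum_of_nonempty (nonempty_range_iff.2 hJ0.ne') fun j hj => h j (mem_range.1 hj)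
  have h2 : ∑ j ∈ range J, ∑ v, (if t (j + 1) ≤ x v ∧ x v < t j then x v ^ 2 else 0) ≤ 1 := by
    rw [sum_comm, ← hx2]
    refine sum_le_sum fun v _ => ?_
    have tele : ∀ j, (if t (j + 1) ≤ x v ∧ x v < t j then x v ^ 2 else 0) =
        (if t (j + 1) ≤ x v then x v ^ 2 else 0) - (if t j ≤ x v then x v ^ 2 else 0) := by
      intro j
      have := ht j.le_succ
      split_ifs <;> grind
    rw [sum_congr rfl fun j _ => tele j,
      sum_range_sub (fun j => if t j ≤ x v then x v ^ 2 else 0)]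
    have := sq_nonneg (x v)
    split_ifs <;> linarith
  rw [sum_const, card_range, nsmul_eq_mul] at h1
  linarith

/-- The absolute values of a normalised eigenvector. -/
lemma exists_unit_nonneg_le_sum_adjMatrix {V : Type*} [Fintype V] (G : SimpleGraph V)
    [DecidableRel G.Adj] {lam : ℝ} {x : V → ℝ} (hx0 : x ≠ 0)
    (hx : (G.adjMatrix ℝ) *ᵥ x = lam • x) :
    ∃ y : V → ℝ, (∀ v, 0 ≤ y v) ∧ ∑ v, y v ^ 2 = 1 ∧
      lam ≤ ∑ u, ∑ v, G.adjMatrix ℝ u v * (y u * y v) := by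
  set n : ℝ := ∑ v, x v ^ 2 with hn
  have hn0 : 0 < n := by
    obtain ⟨v, hv⟩ := Function.ne_iff.1 hx0
    exact sum_pos' (fun _ _ => sq_nonneg _) ⟨v, mem_univ v, sq_pos_of_ne_zero hv⟩
  have hsq : √n ^ 2 = n := Real.sq_sqrt hn0.le
  refine ⟨fun v => |x v| / √n, fun v => by positivity, ?_, ?_⟩
  · simp only [div_pow, sq_abs, hsq, ← sum_div]
    exact div_self hn0.ne'
  · have h1 : lam * n = ∑ u, ∑ v, G.adjMatrix ℝ u v * (x u * x v) := by
      rw [hn, mul_sum]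
      refine sum_congr rfl fun u _ => ?_
      have := congrFun hx u
      simp only [mulVec, dotProduct, Pi.smul_apply, smul_eq_mul] at this
      rw [sq, ← mul_assoc, ← this, sum_mul]
      exact sum_congr rfl fun v _ => by ring
    have h2 : ∑ u, ∑ v, G.adjMatrix ℝ u v * (x u * x v) ≤
        n * ∑ u, ∑ v, G.adjMatrix ℝ u v * (|x u| / √n * (|x v| / √n)) := by
      simp only [mul_sum]
      refine sum_le_sum fun u _ => sum_le_sum fun v _ => ?_
      have e : n * (G.adjMatrix ℝ u v * (|x u| / √n * (|x v| / √n))) =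
          G.adjMatrix ℝ u v * (|x u| * |x v|) := by
        rw [div_mul_div_comm, ← sq, hsq]; field_simp
      rw [e, ← abs_mul]
      refine mul_le_mul_of_nonneg_left (le_abs_self _) ?_
      simp only [SimpleGraph.adjMatrix_apply]; split_ifs <;> norm_num
    rw [← h1, mul_comm] at h2
    exact le_of_mul_le_mul_left h2 hn0

/-- Edge-spectral Erdős–Stone–Simonovits: for `χ(F) = r + 1 ≥ 3` and `ε > 0`
there is `C` with `λ(G) ≤ sqrt((1 - 1/r + ε)·2m) + C` for every `F`-free `G`. -/
theorem stmt_7 {W : Type} [Fintype W] (F : SimpleGraph W) (r : ℕ) (hr : 2 ≤ r)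
    (hχ : F.chromaticNumber = (r + 1 : ℕ)) (ε : ℝ) (hε : 0 < ε) :
    ∃ C : ℝ, ∀ (V : Type) [Fintype V] [DecidableEq V] (G : SimpleGraph V)
      [DecidableRel G.Adj] (lam : ℝ), IsSpectralRadius G lam →
      (¬ ∃ f : F →g G, Function.Injective f) →
      lam ≤ Real.sqrt ((1 - 1 / (r : ℝ) + ε) * (2 * (G.edgeFinset.card : ℝ))) + C := by
  have hcol : F.Colorable (r + 1) := SimpleGraph.chromaticNumber_le_iff_colorable.1 hχ.le
  have hc : 1 / 2 ≤ 1 - 1 / (r : ℝ) := by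
    have : 1 / (r : ℝ) ≤ 1 / 2 := one_div_le_one_div_of_le two_pos (by exact_mod_cast hr)
    linarith
  obtain ⟨δ, hδ, hdens⟩ := exists_forall_sum_adjMatrix_mul_le (by lia) hcol (half_pos hε)
  set c : ℝ := 1 - 1 / (r : ℝ) with hcdef
  have hgap : 0 < √(c + ε) - √(c + ε / 2) :=
    sub_pos.2 (Real.sqrt_lt_sqrt (by linarith) (by linarith))
  set η : ℝ := min 1 ((√(c + ε) - √(c + ε / 2)) / 6) with hη
  have hη0 : 0 < η := lt_min one_pos (by positivity)
  have hη1 : η ≤ 1 := min_le_left _ _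
  have hη6 : 6 * η + √(c + ε / 2) ≤ √(c + ε) := by
    have : η ≤ (√(c + ε) - √(c + ε / 2)) / 6 := min_le_right _ _
    linarith
  obtain ⟨J, hJ⟩ := exists_nat_ge (1 / η ^ 2)
  have hJη : 1 ≤ J * η ^ 2 := (div_le_iff₀ (by positivity)).1 hJ
  have hJ0 : 0 < J := Nat.pos_of_ne_zero (by rintro rfl; norm_num at hJη)
  let t : ℕ → ℝ := fun j => √δ * (η ^ 2) ^ j
  have ht0 : ∀ j, 0 < t j := fun j => by positivity
  have hts : ∀ j, t (j + 1) = η ^ 2 * t j := fun j => by simp only [t]; ring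
  have ht : Antitone t := antitone_nat_of_succ_le fun j => by
    rw [hts]
    exact mul_le_of_le_one_left (ht0 j).le (pow_le_one₀ hη0.le hη1)
  refine ⟨(t J)⁻¹ ^ 2 + (t J * t J * η)⁻¹, fun V _ _ G _ lam hlam hG => ?_⟩
  by_contra! hlt
  obtain ⟨x, hx0, hx⟩ := hlam.1
  obtain ⟨y, hy, hy2, hle⟩ := exists_unit_nonneg_le_sum_adjMatrix G hx0 hx
  obtain ⟨j, hj, hmid⟩ := exists_sum_level_le y hy2 ht hJη hJ0
  have htJ := ht0 J
  have htj := ht0 j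
  have hsqrt := Real.sqrt_nonneg ((c + ε) * (2 * (#G.edgeFinset : ℝ)))
  have hC1 : 0 < (t J)⁻¹ ^ 2 := by positivity
  have hC2 : 0 < (t J * t J * η)⁻¹ := by positivity
  have hlam0 : 0 < lam := by linarith
  have hm : ∑ u, ∑ v, G.adjMatrix ℝ u v = 2 * (#G.edgeFinset : ℝ) := by
    have h := G.sum_degrees_eq_twice_card_edges
    have hd : ∀ u, ∑ v, G.adjMatrix ℝ u v = (G.degree u : ℝ) := fun u => by
      rw [← SimpleGraph.card_neighborFinset_eq_degree, SimpleGraph.neighborFinset_eq_filter]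
      simp [SimpleGraph.adjMatrix_apply]
    rw [sum_congr rfl fun u _ => hd u]
    exact_mod_cast h
  have hm0 : (0 : ℝ) ≤ #G.edgeFinset := Nat.cast_nonneg _
  have hmlam : 2 * (#G.edgeFinset : ℝ) ≤ 2 * lam ^ 2 := by
    have h1 : (c + ε) * (2 * (#G.edgeFinset : ℝ)) ≤ lam ^ 2 :=
      (Real.sqrt_le_left hlam0.le).1 (by linarith)
    nlinarith
  have hκ : (t j * η * lam)⁻¹ ≤ η ^ 2 * t j := by
    rw [← hts]
    have h1 : t J ≤ t (j + 1) := ht hj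
    have h2 : t J ≤ t j := ht hj.le
    have h3 : 1 ≤ t J * t J * η * lam := by
      rw [← inv_le_iff_one_le_mul₀' (by positivity)]
      linarith
    rw [inv_le_iff_one_le_mul₀ (by positivity)]
    calc 1 ≤ t J * t J * η * lam := h3
      _ ≤ t (j + 1) * t j * η * lam := by have := ht0 (j + 1); gcongr
      _ = _ := by ring
  have hbound := sum_mul_mul_le_of_thresholds (fun u v => G.adjMatrix ℝ u v)
    (fun u v => by simp only [SimpleGraph.adjMatrix_apply]; split_ifs <;> norm_num)
    (fun u v => by simp only [SimpleGraph.adjMatrix_apply]; split_ifs <;> norm_num)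
    (fun u v => by simp [SimpleGraph.adjMatrix_apply, G.adj_comm])
    y hy hy2 htj hη0 hη1 hlam0 hκ hc (hm.trans_le hmlam) hle
    (by simpa only [hts] using hmid) (fun p hp hpβ hp1 =>
      hdens V G (fun ⟨f⟩ => hG ⟨f.toHom, f.injective'⟩) p hp (fun v => (hpβ v).trans ?_) hp1)
  · rw [hm, ← hts] at hbound
    have h1 : (t (j + 1))⁻¹ ^ 2 ≤ (t J)⁻¹ ^ 2 :=
      pow_le_pow_left₀ (inv_nonneg.2 (ht0 _).le) (inv_anti₀ htJ (ht hj)) 2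
    have h2 : √(2 * (#G.edgeFinset : ℝ)) * (6 * η + √(c + ε / 2)) ≤
        √((c + ε) * (2 * (#G.edgeFinset : ℝ))) := by
      rw [mul_comm (c + ε), Real.sqrt_mul (mul_nonneg zero_le_two hm0) (c + ε)]
      exact mul_le_mul_of_nonneg_left hη6 (Real.sqrt_nonneg _)
    linarith
  · rw [← hts]
    calc t (j + 1) ^ 2 ≤ t 0 ^ 2 := pow_le_pow_left₀ (ht0 _).le (ht (Nat.zero_le _)) 2
      _ = δ := by simp [t, Real.sq_sqrt hδ.le]
end

section
/- Let G be a K₄-free graph with m edges, let λ = λ(G) be its spectral radius and k₃(G) its number of triangles. Then λ³ ≤ m·λ + 2·k₃(G). -/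
open Finset Matrix

/-- A graph with a largest adjacency eigenvalue has a nonnegative eigenvector for it. -/
theorem IsSpectralRadius.exists_nonneg_eigenvector {V : Type*} [Fintype V] [DecidableEq V]
    {G : SimpleGraph V} [DecidableRel G.Adj] {lam : ℝ} (h : IsSpectralRadius G lam) :
    ∃ z : V → ℝ, (∀ v, 0 ≤ z v) ∧ 0 < ∑ v, z v ∧ (G.adjMatrix ℝ) *ᵥ z = lam • z := by
  obtain ⟨⟨x, hx0, hx⟩, hmax⟩ := h
  have hherm : (lam • (1 : Matrix V V ℝ) - G.adjMatrix ℝ).IsHermitian := by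
    simp [Matrix.IsHermitian]
  have hpsd : (lam • (1 : Matrix V V ℝ) - G.adjMatrix ℝ).PosSemidef := by
    rw [hherm.posSemidef_iff_eigenvalues_nonneg]
    intro i
    have hi := hherm.mulVec_eigenvectorBasis i
    have hne : (WithLp.ofLp (hherm.eigenvectorBasis i) : V → ℝ) ≠ 0 := by
      intro h0
      exact hherm.eigenvectorBasis.orthonormal.ne_zero i (by ext v; exact congrFun h0 v)
    have := hmax (lam - hherm.eigenvalues i) ⟨_, hne, by
      rw [Matrix.sub_mulVec, Matrix.smul_mulVec, Matrix.one_mulVec] at hi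
      rw [sub_smul, ← hi]
      abel⟩
    simpa using this
  have hnonneg : ∀ v, 0 ≤ |x v| := fun v ↦ abs_nonneg _
  refine ⟨fun v ↦ |x v|, hnonneg, ?_, ?_⟩
  · obtain ⟨v, hv⟩ := Function.ne_iff.mp hx0
    exact Finset.sum_pos' (fun v _ ↦ hnonneg v) ⟨v, Finset.mem_univ v, abs_pos.mpr hv⟩
  · set z : V → ℝ := fun v ↦ |x v| with hz
    have hle : x ⬝ᵥ (G.adjMatrix ℝ) *ᵥ x ≤ z ⬝ᵥ (G.adjMatrix ℝ) *ᵥ z := by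
      simp only [dotProduct, Matrix.mulVec, Finset.mul_sum]
      refine Finset.sum_le_sum fun u _ ↦ Finset.sum_le_sum fun v _ ↦ ?_
      rw [SimpleGraph.adjMatrix_apply]
      split_ifs
      · simpa [hz, abs_mul] using le_abs_self (x u * x v)
      · simp
    have hzz : z ⬝ᵥ z = x ⬝ᵥ x := by simp [dotProduct, hz]
    have hkey : star z ⬝ᵥ (lam • (1 : Matrix V V ℝ) - G.adjMatrix ℝ) *ᵥ z = 0 := by
      refine le_antisymm ?_ (hpsd.dotProduct_mulVec_nonneg z)
      rw [hx, dotProduct_smul] at hle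
      rw [star_trivial, Matrix.sub_mulVec, Matrix.smul_mulVec, Matrix.one_mulVec,
        dotProduct_sub, dotProduct_smul, hzz]
      linarith
    have := (hpsd.dotProduct_mulVec_zero_iff z).mp hkey
    rw [Matrix.sub_mulVec, Matrix.smul_mulVec, Matrix.one_mulVec, sub_eq_zero] at this
    exact this.symm

namespace SimpleGraph

/-- In a `K₄`-free graph a vertex is adjacent to at most two vertices of a triangle. -/
theorem CliqueFree.card_filter_adj_le_two {V : Type*} [DecidableEq V] {G : SimpleGraph V}
    [DecidableRel G.Adj] (hG : G.CliqueFree 4) {T : Finset V} (hT : G.IsNClique 3 T) (y : V) :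
    #{u ∈ T | G.Adj u y} ≤ 2 := by
  by_contra! hlt
  have heq : {u ∈ T | G.Adj u y} = T :=
    eq_of_subset_of_card_le (filter_subset _ _) (by rw [hT.card_eq]; omega)
  refine hG (insert y T) (hT.insert fun u hu ↦ ?_)
  rw [← heq] at hu
  exact (mem_filter.mp hu).2.symm

theorem sum_degree_mul_eq {V : Type*} [Fintype V] {G : SimpleGraph V} [DecidableRel G.Adj]
    (z : V → ℝ) {lam : ℝ} (hz : (G.adjMatrix ℝ) *ᵥ z = lam • z) :
    ∑ u, G.degree u * z u = lam * ∑ u, z u := by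
  have h1 : ∑ u, ∑ v, G.adjMatrix ℝ u v * z v = lam * ∑ u, z u := by
    rw [mul_sum]
    exact sum_congr rfl fun u _ ↦ congrFun hz u
  rw [← h1, sum_comm]
  refine sum_congr rfl fun v _ ↦ ?_
  rw [← sum_mul]
  congr 1
  simp [adjMatrix_apply, adj_comm, ← card_neighborFinset_eq_degree, neighborFinset_eq_filter]

variable {V : Type*} [Fintype V] [DecidableEq V] (G : SimpleGraph V) [DecidableRel G.Adj]

/-- Each triangle through `w` comes from at most two ordered pairs of neighbours of `w`. -/
theorem card_adj_pairs_le_two_mul_card_triangles (w : V) :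
    #{p : V × V | G.Adj p.1 p.2 ∧ G.Adj p.1 w ∧ G.Adj p.2 w} ≤
      2 * #{T ∈ G.cliqueFinset 3 | w ∈ T} := by
  refine Finset.card_le_mul_card_image_of_maps_to (f := fun p ↦ {p.1, p.2, w}) ?_ 2 ?_
  · rintro ⟨u, v⟩ hp
    simp only [mem_filter, mem_univ, true_and, mem_cliqueFinset_iff] at hp ⊢
    exact ⟨is3Clique_triple_iff.mpr ⟨hp.1, hp.2.1, hp.2.2⟩, by simp⟩
  · intro T hT
    simp only [mem_filter, mem_cliqueFinset_iff] at hT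
    have hcard : #(T.erase w).offDiag = 2 := by
      rw [offDiag_card, card_erase_of_mem hT.2, hT.1.card_eq]
    rw [← hcard]
    refine card_le_card ?_
    rintro ⟨u, v⟩ hp
    simp only [mem_filter, mem_univ, true_and] at hp
    obtain ⟨⟨huv, huw, hvw⟩, rfl⟩ := hp
    simp [huv.ne, huw.ne, hvw.ne]

variable {G}

theorem sum_cliqueFinset_sum (z : V → ℝ) (n : ℕ) :
    ∑ T ∈ G.cliqueFinset n, ∑ u ∈ T, z u = ∑ w, #{T ∈ G.cliqueFinset n | w ∈ T} * z w := by
  have (T : Finset V) : ∑ u ∈ T, z u = ∑ u, if u ∈ T then z u else 0 := by simp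
  simp_rw [this]
  rw [sum_comm]
  refine sum_congr rfl fun w _ ↦ ?_
  rw [← sum_filter, sum_const, nsmul_eq_mul]

/-- The triangle-weighted sum of a nonnegative eigenvector of a `K₄`-free graph. -/
theorem CliqueFree.mul_sum_triangles_le (hG : G.CliqueFree 4) {z : V → ℝ} {lam : ℝ}
    (hz0 : ∀ v, 0 ≤ z v) (hz : (G.adjMatrix ℝ) *ᵥ z = lam • z) :
    lam * ∑ w, #{T ∈ G.cliqueFinset 3 | w ∈ T} * z w ≤
      2 * #(G.cliqueFinset 3) * ∑ v, z v := by
  rw [← sum_cliqueFinset_sum, mul_sum]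
  have key : ∀ T ∈ G.cliqueFinset 3, lam * ∑ u ∈ T, z u ≤ 2 * ∑ v, z v := by
    intro T hT
    have h1 : lam * ∑ u ∈ T, z u = ∑ y, (#{u ∈ T | G.Adj u y} : ℝ) * z y := by
      have (u : V) : lam * z u = ∑ y, G.adjMatrix ℝ u y * z y := (congrFun hz u).symm
      simp_rw [mul_sum, this]
      rw [sum_comm]
      refine sum_congr rfl fun y _ ↦ ?_
      rw [← sum_mul]
      simp [adjMatrix_apply]
    rw [h1, mul_sum]
    refine sum_le_sum fun y _ ↦ mul_le_mul_of_nonneg_right ?_ (hz0 y)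
    exact_mod_cast hG.card_filter_adj_le_two (mem_cliqueFinset_iff.mp hT) y
  calc _ ≤ ∑ T ∈ G.cliqueFinset 3, 2 * ∑ v, z v := sum_le_sum key
    _ = _ := by rw [sum_const, nsmul_eq_mul]; ring

/-- The degrees of the neighbours of `w` sum to at most the number of edges plus the number of
triangles through `w`. -/
theorem sum_adjMatrix_mul_degree_le (w : V) :
    ∑ u, G.adjMatrix ℝ u w * G.degree u ≤
      #G.edgeFinset + #{T ∈ G.cliqueFinset 3 | w ∈ T} := by
  have hdeg (u : V) : (G.degree u : ℝ) = ∑ v, G.adjMatrix ℝ u v := by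
    simp [adjMatrix_apply, ← card_neighborFinset_eq_degree, neighborFinset_eq_filter]
  have h1 : ∑ u, G.adjMatrix ℝ u w * G.degree u =
      ∑ u, ∑ v, G.adjMatrix ℝ u v * G.adjMatrix ℝ u w := by
    simp_rw [hdeg, mul_sum, mul_comm]
  have h2 : ∑ u, G.adjMatrix ℝ u w * G.degree u =
      ∑ u, ∑ v, G.adjMatrix ℝ u v * G.adjMatrix ℝ v w := by
    rw [h1, sum_comm]
    simp_rw [adjMatrix_apply, G.adj_comm]
  have hedge : 2 * (#G.edgeFinset : ℝ) = ∑ u, ∑ v, G.adjMatrix ℝ u v := by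
    simp_rw [← hdeg]
    exact_mod_cast G.sum_degrees_eq_twice_card_edges.symm
  have htri : ∑ u, ∑ v, G.adjMatrix ℝ u v * (G.adjMatrix ℝ u w * G.adjMatrix ℝ v w) ≤
      2 * #{T ∈ G.cliqueFinset 3 | w ∈ T} := by
    refine le_trans (le_of_eq ?_)
      (by exact_mod_cast G.card_adj_pairs_le_two_mul_card_triangles w :
        (#{p : V × V | G.Adj p.1 p.2 ∧ G.Adj p.1 w ∧ G.Adj p.2 w} : ℝ) ≤ _)
    rw [← Fintype.sum_prod_type', ← sum_boole]
    refine sum_congr rfl fun p _ ↦ ?_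
    simp only [adjMatrix_apply, ite_and, ite_mul, one_mul, zero_mul]
  have hmain : (∑ u, ∑ v, G.adjMatrix ℝ u v * G.adjMatrix ℝ u w) +
      ∑ u, ∑ v, G.adjMatrix ℝ u v * G.adjMatrix ℝ v w ≤
      (∑ u, ∑ v, G.adjMatrix ℝ u v) +
        ∑ u, ∑ v, G.adjMatrix ℝ u v * (G.adjMatrix ℝ u w * G.adjMatrix ℝ v w) := by
    simp_rw [← sum_add_distrib]
    refine sum_le_sum fun u _ ↦ sum_le_sum fun v _ ↦ ?_
    simp only [adjMatrix_apply]
    split_ifs <;> norm_num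
  linarith

end SimpleGraph

/-- Nikiforov's clique–spectral inequality for `K₄`-free graphs:
`λ³ ≤ m λ + 2 k₃(G)`. -/
theorem stmt_19 {V : Type*} [Fintype V] [DecidableEq V] (G : SimpleGraph V)
    [DecidableRel G.Adj] (hG : G.CliqueFree 4)
    (lam : ℝ) (hlam : IsSpectralRadius G lam) :
    lam ^ 3 ≤ (G.edgeFinset.card : ℝ) * lam + 2 * ((G.cliqueFinset 3).card : ℝ) := by
  obtain ⟨z, hz0, hS, hz⟩ := hlam.exists_nonneg_eigenvector
  have hdeg := SimpleGraph.sum_degree_mul_eq z hz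
  have htri := hG.mul_sum_triangles_le hz0 hz
  have hlam0 : 0 ≤ lam := by
    have : 0 ≤ lam * ∑ u, z u :=
      hdeg ▸ Finset.sum_nonneg fun u _ ↦ mul_nonneg (Nat.cast_nonneg _) (hz0 u)
    exact nonneg_of_mul_nonneg_left this hS
  have hedge : lam * (lam * ∑ u, z u) ≤ #G.edgeFinset * ∑ u, z u +
      ∑ w, #{T ∈ G.cliqueFinset 3 | w ∈ T} * z w := by
    have h1 : lam * (lam * ∑ u, z u) =
        ∑ w, (∑ u, G.adjMatrix ℝ u w * G.degree u) * z w := by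
      have (u : V) : lam * z u = ∑ w, G.adjMatrix ℝ u w * z w := (congrFun hz u).symm
      rw [← hdeg, mul_sum]
      simp_rw [sum_mul, mul_left_comm lam, this, mul_sum]
      rw [sum_comm]
      exact sum_congr rfl fun w _ ↦ sum_congr rfl fun u _ ↦ by ring
    rw [h1, mul_sum, ← sum_add_distrib]
    refine sum_le_sum fun w _ ↦ ?_
    rw [← add_mul]
    exact mul_le_mul_of_nonneg_right (SimpleGraph.sum_adjMatrix_mul_degree_le w) (hz0 w)
  refine le_of_mul_le_mul_right ?_ hS
  have := mul_le_mul_of_nonneg_left hedge hlam0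
  linarith
end
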